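/- Let G be a simple graph on a vertex set V, let f_1, …, f_k be partial bijections of V such that for each j and each x in the domain of f_j, x is adjacent to f_j(x), such that each f_j has no 2-cycles (f_j(x) = y and y in the domain of f_j implies f_j(y) ≠ x), and such that the sets of edges realized by distinct f_j are disjoint. Let g be a nonempty reduced word in the letters a_1^{±1}, …, a_k^{±1} of length n, and let θ_g be the composite partial bijection obtained by applying, in order, f_j for each letter a_j and f_j^{-1} for each letter a_j^{-1}. If θ_g is defined at some vertex v with θ_g(v) = v, then G contains a cycle of length at most n. In particular, if the girth of G exceeds n, then θ_g has no fixed vertex. -/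

import Mathlib

/-- A closed walk of positive length without backtracking contains a cycle among its edges, hence a
cycle that is at most as long as the walk. -/
theorem SimpleGraph.Walk.exists_isCycle_length_le_of_isChain_edges {V : Type*}
    {G : SimpleGraph V} {v : V} (p : G.Walk v v) (hp : ¬ p.Nil)
    (hchain : List.IsChain (· ≠ ·) p.edges) :
    ∃ (u : V) (c : G.Walk u u), c.IsCycle ∧ c.length ≤ p.length := by
  classical
  let H : SimpleGraph V := SimpleGraph.fromEdgeSet {e | e ∈ p.edges}
  have hmem : ∀ e ∈ H.edgeSet, e ∈ p.edges := by
    intro e he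
    rw [SimpleGraph.edgeSet_fromEdgeSet] at he
    exact he.1
  have hle : H ≤ G := SimpleGraph.edgeSet_subset_edgeSet.mp fun e he =>
    p.edges_subset_edgeSet (hmem e he)
  have hpH : ∀ e ∈ p.edges, e ∈ H.edgeSet := by
    intro e he
    rw [SimpleGraph.edgeSet_fromEdgeSet]
    exact ⟨he, G.not_isDiag_of_mem_edgeSet (p.edges_subset_edgeSet he)⟩
  have hcyc : ¬ H.IsAcyclic := by
    intro hH
    have hpath : (p.transfer H hpH).IsPath := by
      rw [hH.isPath_iff_isChain, SimpleGraph.Walk.edges_transfer]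
      exact hchain
    have hnil := SimpleGraph.Walk.length_eq_zero_iff.mpr
      (SimpleGraph.Walk.isPath_iff_nil.mp hpath)
    rw [SimpleGraph.Walk.length_transfer] at hnil
    exact hp (SimpleGraph.Walk.length_eq_zero_iff.mp hnil)
  simp only [SimpleGraph.IsAcyclic, not_forall, not_not] at hcyc
  obtain ⟨u, c, hc⟩ := hcyc
  refine ⟨u, c.mapLe hle, hc.mapLe hle, ?_⟩
  rw [SimpleGraph.Walk.length_map, ← c.length_edges, ← p.length_edges]
  exact (hc.isTrail.edges_nodup.subperm fun e he =>
    hmem e (c.edges_subset_edgeSet he)).length_le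

/-- If each member of a family of partial bijections moves vertices along edges of `G`, then
whenever a composite of members of the family is defined at a vertex, the successive images of that
vertex form a walk in `G`. -/
theorem PEquiv.exists_walk_of_foldl_trans_eq_some {V ι : Type*} {G : SimpleGraph V}
    {g : ι → PEquiv V V} (hg : ∀ i x y, g i x = some y → G.Adj x y) (w : List ι)
    (p : PEquiv V V) {x z : V}
    (h : (w.map g).foldl (fun p q => p.trans q) p x = some z) :
    ∃ y, p x = some y ∧
      ∃ c : G.Walk y z, List.Forall₂ (fun i d => g i d.fst = some d.snd) w c.darts := by
  induction w generalizing p with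
  | nil => exact ⟨z, h, SimpleGraph.Walk.nil, List.Forall₂.nil⟩
  | cons i w ih =>
    obtain ⟨y', hy', c, hc⟩ := ih (p.trans (g i)) h
    obtain ⟨y, hy, hi⟩ := (PEquiv.trans_eq_some p (g i) x y').mp hy'
    exact ⟨y, hy, SimpleGraph.Walk.cons (hg i y y' hi) c, List.Forall₂.cons hi hc⟩

/-- If letters that are allowed to be adjacent never send a vertex forth and back, then a walk
traced by a word without forbidden adjacencies does not backtrack. -/
theorem SimpleGraph.Walk.isChain_edges_of_forall₂_darts {V ι : Type*} {G : SimpleGraph V}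
    {g : ι → PEquiv V V} {R : ι → ι → Prop}
    (hR : ∀ i j, R i j → ∀ x y, g i x = some y → g j y ≠ some x) {w : List ι}
    (hw : w.IsChain R) {x z : V} (c : G.Walk x z)
    (hc : List.Forall₂ (fun i d => g i d.fst = some d.snd) w c.darts) :
    List.IsChain (· ≠ ·) c.edges := by
  induction c generalizing w with
  | nil => simp
  | cons h c ih =>
    rw [SimpleGraph.Walk.darts_cons] at hc
    obtain _ | ⟨hi, hc⟩ := hc
    have hchain := ih hw.tail hc
    cases c with
    | nil => simp
    | cons h' c =>
      rw [SimpleGraph.Walk.darts_cons] at hc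
      obtain _ | ⟨hj, hc⟩ := hc
      simp only [SimpleGraph.Walk.edges_cons, List.isChain_cons_cons] at hw hchain ⊢
      refine ⟨fun he => ?_, hchain⟩
      rw [Sym2.eq_iff] at he
      obtain ⟨rfl, -⟩ | ⟨rfl, -⟩ := he
      · exact G.irrefl h
      · exact hR _ _ hw.1 _ _ hi hj

/-- Let `G` be a simple graph and `f 0, …, f (k-1)` partial bijections of the vertex set
(modelled as partial equivalences `PEquiv V V`) such that each `f j` moves vertices only
along edges of `G`, each `f j` has no 2-cycles, and the sets of edges realized by distinct
`f j` are disjoint.  Let `w` be a nonempty reduced word in the letters `a j ^ ±1` (encoded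
as a list of pairs `(j, b)`, where `b = true` stands for `a j` and `b = false` for
`a j ⁻¹`), and let `θ` be the corresponding composite partial bijection.  If `θ` fixes a
vertex, then `G` contains a cycle of length at most the length of `w`; in particular, if
the girth of `G` exceeds the length of `w`, then `θ` has no fixed vertex. -/
theorem fixed_point_of_reduced_word_gives_short_cycle {V : Type*} (G : SimpleGraph V)
    (k : ℕ) (f : Fin k → PEquiv V V)
    (hadj : ∀ (j : Fin k) (x y : V), f j x = some y → G.Adj x y)
    (htwo : ∀ (j : Fin k) (x y : V), f j x = some y → f j y ≠ some x)
    (hdisj : ∀ (j j' : Fin k), j ≠ j' → ∀ x y : V,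
      (f j x = some y ∨ f j y = some x) → ¬ (f j' x = some y ∨ f j' y = some x))
    (w : List (Fin k × Bool)) (hne : w ≠ [])
    (hred : List.Chain' (fun a b => a.1 = b.1 → a.2 = b.2) w)
    (θ : PEquiv V V)
    (hθ : θ = (w.map fun l => if l.2 then f l.1 else (f l.1).symm).foldl
      (fun p g => p.trans g) (PEquiv.refl V)) :
    (∀ v : V, θ v = some v →
      ∃ (u : V) (c : G.Walk u u), c.IsCycle ∧ c.length ≤ w.length) ∧
    ((w.length : ℕ∞) < G.girth → ∀ v : V, θ v ≠ some v) := by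
  set g : Fin k × Bool → PEquiv V V := fun l => if l.2 then f l.1 else (f l.1).symm
  have hg : ∀ l x y, g l x = some y → f l.1 x = some y ∨ f l.1 y = some x := by
    rintro ⟨j, _ | _⟩ x y h
    · exact Or.inr ((f j).eq_some_iff.mp h)
    · exact Or.inl h
  have hgadj : ∀ l x y, g l x = some y → G.Adj x y := fun l x y h =>
    (hg l x y h).elim (hadj l.1 x y) fun h' => (hadj l.1 y x h').symm
  have hback : ∀ l m : Fin k × Bool, (l.1 = m.1 → l.2 = m.2) →
      ∀ x y, g l x = some y → g m y ≠ some x := by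
    intro l m hlm x y hl hm
    by_cases hj : l.1 = m.1
    · obtain rfl : l = m := Prod.ext hj (hlm hj)
      obtain ⟨j, _ | _⟩ := l
      · exact htwo j y x ((f j).eq_some_iff.mp hl) ((f j).eq_some_iff.mp hm)
      · exact htwo j x y hl hm
    · exact hdisj _ _ hj x y (hg l x y hl) (hg m y x hm).symm
  have hcycle : ∀ v : V, θ v = some v →
      ∃ (u : V) (c : G.Walk u u), c.IsCycle ∧ c.length ≤ w.length := by
    intro v hv
    rw [hθ] at hv
    obtain ⟨y, hy, c, hc⟩ := PEquiv.exists_walk_of_foldl_trans_eq_some hgadj w _ hv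
    obtain rfl : v = y := Option.some.inj hy
    have hlen : w.length = c.length := hc.length_eq.trans c.length_darts
    rw [hlen]
    refine c.exists_isCycle_length_le_of_isChain_edges (fun hnil => hne ?_)
      (c.isChain_edges_of_forall₂_darts hback hred hc)
    rw [← List.length_eq_zero_iff, hlen, SimpleGraph.Walk.length_eq_zero_iff.mpr hnil]
  refine ⟨hcycle, fun hgirth v hv => ?_⟩
  obtain ⟨u, c, hc, hle⟩ := hcycle v hv
  exact absurd (SimpleGraph.girth_le_length hc) (by
    have := Nat.cast_lt.mp hgirth
    omega)
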